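/- Cauchy–Schwarz bound for the linearized source term: there exists a finite constant C > 0, depending only on m, k_B, δ, α, β, C_r, n, u, T_tr, T_int, such that for every measurable D̃ : ℝ³ × (0,∞) → ℝ with ∫_{ℝ³×[0,∞)} D̃(ξ,I)² M_r(ξ,I) dξ dI < ∞ and with the left-hand integral absolutely convergent, one has ( ∫_{ℝ³×[0,∞)} I · Q_s(M_r, M_r D̃)(ξ,I) dξ dI )² ≤ C · ∫_{ℝ³×[0,∞)} D̃(ξ,I)² M_r(ξ,I) dξ dI. -/

import Mathlib

noncomputable section

open MeasureTheory Real
open scoped BigOperators RealInnerProductSpace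

abbrev V3 : Type := EuclideanSpace ℝ (Fin 3)

abbrev Sph : Type := Metric.sphere (0 : V3) 1

/-- The surface measure on the unit sphere `S²` (total mass `4π`). -/
def sphMeasure : Measure Sph := (volume : Measure V3).toSphere

/-- The measure `dξ dI` on `ℝ³ × [0,∞)`. -/
def phaseMeasure : Measure (V3 × ℝ) :=
  (volume : Measure V3).prod ((volume : Measure ℝ).restrict (Set.Ici 0))

/-- Total energy `E = (m/4)|ξ−ξ_*|² + I + I_*` in the center-of-mass frame. -/
def collE (m : ℝ) (ξ ξs : V3) (I Is : ℝ) : ℝ :=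
  m / 4 * ‖ξ - ξs‖ ^ 2 + I + Is

/-- Post-collisional velocity `ξ'` for standard (Borgnakke–Larsen) collisions. -/
def xiPrimeStd (m : ℝ) (ξ ξs : V3) (I Is R : ℝ) (σ : Sph) : V3 :=
  (1 / 2 : ℝ) • (ξ + ξs) + Real.sqrt (R * collE m ξ ξs I Is / m) • (σ : V3)

/-- Post-collisional velocity `ξ_*'` for standard collisions. -/
def xiStarPrimeStd (m : ℝ) (ξ ξs : V3) (I Is R : ℝ) (σ : Sph) : V3 :=
  (1 / 2 : ℝ) • (ξ + ξs) - Real.sqrt (R * collE m ξ ξs I Is / m) • (σ : V3)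

/-- Post-collisional internal energy `I' = r(1−R)E` for standard collisions. -/
def IPrimeStd (m : ℝ) (ξ ξs : V3) (I Is R r : ℝ) : ℝ :=
  r * (1 - R) * collE m ξ ξs I Is

/-- Post-collisional internal energy `I_*' = (1−r)(1−R)E` for standard collisions. -/
def IStarPrimeStd (m : ℝ) (ξ ξs : V3) (I Is R r : ℝ) : ℝ :=
  (1 - r) * (1 - R) * collE m ξ ξs I Is

/-- Integrand of the standard collision operator `Q_s`. -/
def stdIntegrand (m δ α β Cs : ℝ) (f F : V3 → ℝ → ℝ)
    (ξ : V3) (I : ℝ) (ξs : V3) (Is : ℝ) (σ : Sph) (r R : ℝ) : ℝ :=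
  ((f (xiPrimeStd m ξ ξs I Is R σ) (IPrimeStd m ξ ξs I Is R r) *
        F (xiStarPrimeStd m ξ ξs I Is R σ) (IStarPrimeStd m ξ ξs I Is R r) +
      f (xiStarPrimeStd m ξ ξs I Is R σ) (IStarPrimeStd m ξ ξs I Is R r) *
        F (xiPrimeStd m ξ ξs I Is R σ) (IPrimeStd m ξ ξs I Is R r)) /
      (IPrimeStd m ξ ξs I Is R r * IStarPrimeStd m ξ ξs I Is R r) ^ (δ / 2 - 1) -
    (f ξ I * F ξs Is + f ξs Is * F ξ I) / (I * Is) ^ (δ / 2 - 1)) *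
  (Cs * (I + Is) ^ α * ‖ξ - ξs‖ ^ β * (I * Is) ^ (δ / 2 - 1) *
    (r * (1 - r)) ^ (δ / 2 - 1) * (1 - R) ^ (α + δ - 1) * R ^ ((β + 1) / 2))

/-- The standard (inelastic) collision operator `Q_s(f,F)`. -/
def Qs (m δ α β Cs : ℝ) (f F : V3 → ℝ → ℝ) (ξ : V3) (I : ℝ) : ℝ :=
  (1 / 2) * ∫ Is in Set.Ici (0 : ℝ), ∫ ξs : V3,
    (∫ σ : Sph, (∫ r in Set.Icc (0 : ℝ) 1, ∫ R in Set.Icc (0 : ℝ) 1,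
      stdIntegrand m δ α β Cs f F ξ I ξs Is σ r R) ∂sphMeasure)

/-- Post-collisional velocity `ξ'` for resonant collisions. -/
def xiPrimeRes (ξ ξs : V3) (σ : Sph) : V3 :=
  (1 / 2 : ℝ) • (ξ + ξs) + (‖ξ - ξs‖ / 2) • (σ : V3)

/-- Post-collisional velocity `ξ_*'` for resonant collisions. -/
def xiStarPrimeRes (ξ ξs : V3) (σ : Sph) : V3 :=
  (1 / 2 : ℝ) • (ξ + ξs) - (‖ξ - ξs‖ / 2) • (σ : V3)

/-- Post-collisional internal energy `I' = r(I+I_*)` for resonant collisions. -/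
def IPrimeRes (I Is r : ℝ) : ℝ := r * (I + Is)

/-- Post-collisional internal energy `I_*' = (1−r)(I+I_*)` for resonant collisions. -/
def IStarPrimeRes (I Is r : ℝ) : ℝ := (1 - r) * (I + Is)

/-- Integrand of the resonant collision operator `Q_r`. -/
def resIntegrand (δ α β Cr : ℝ) (f F : V3 → ℝ → ℝ)
    (ξ : V3) (I : ℝ) (ξs : V3) (Is : ℝ) (σ : Sph) (r : ℝ) : ℝ :=
  ((f (xiPrimeRes ξ ξs σ) (IPrimeRes I Is r) * F (xiStarPrimeRes ξ ξs σ) (IStarPrimeRes I Is r) +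
      f (xiStarPrimeRes ξ ξs σ) (IStarPrimeRes I Is r) * F (xiPrimeRes ξ ξs σ) (IPrimeRes I Is r)) /
      (IPrimeRes I Is r * IStarPrimeRes I Is r) ^ (δ / 2 - 1) -
    (f ξ I * F ξs Is + f ξs Is * F ξ I) / (I * Is) ^ (δ / 2 - 1)) *
  (Cr * (I + Is) ^ α * ‖ξ - ξs‖ ^ β * (I * Is) ^ (δ / 2 - 1) * (r * (1 - r)) ^ (δ / 2 - 1))

/-- The resonant (elastic) collision operator `Q_r(f,F)`. -/
def Qr (δ α β Cr : ℝ) (f F : V3 → ℝ → ℝ) (ξ : V3) (I : ℝ) : ℝ :=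
  (1 / 2) * ∫ Is in Set.Ici (0 : ℝ), ∫ ξs : V3,
    (∫ σ : Sph, (∫ r in Set.Icc (0 : ℝ) 1,
      resIntegrand δ α β Cr f F ξ I ξs Is σ r) ∂sphMeasure)

/-- The Maxwellian equilibrium distribution `M_s`. -/
def Ms (m kB δ n T : ℝ) (u : V3) (ξ : V3) (I : ℝ) : ℝ :=
  n * I ^ (δ / 2 - 1) /
      ((2 * π * kB * T / m) ^ ((3 : ℝ) / 2) * (kB * T) ^ (δ / 2) * Real.Gamma (δ / 2)) *
    Real.exp (-(m * ‖ξ - u‖ ^ 2 + 2 * I) / (2 * kB * T))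

/-- The two-temperature equilibrium distribution `M_r`. -/
def Mr (m kB δ n Ttr Tint : ℝ) (u : V3) (ξ : V3) (I : ℝ) : ℝ :=
  n * I ^ (δ / 2 - 1) /
      ((2 * π * kB * Ttr / m) ^ ((3 : ℝ) / 2) * (kB * Tint) ^ (δ / 2) * Real.Gamma (δ / 2)) *
    Real.exp (-(m * ‖ξ - u‖ ^ 2) / (2 * kB * Ttr) - I / (kB * Tint))

/-- Integrand of the resonant linearized collision operator `L_r`. -/
def LrIntegrand (m kB δ n Ttr Tint α β : ℝ) (u : V3) (h : V3 → ℝ → ℝ)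
    (ξ : V3) (I : ℝ) (Is : ℝ) (ξs : V3) (σ : Sph) (r : ℝ) : ℝ :=
  Mr m kB δ n Ttr Tint u ξs Is *
    (h (xiStarPrimeRes ξ ξs σ) (IStarPrimeRes I Is r) + h (xiPrimeRes ξ ξs σ) (IPrimeRes I Is r) -
      h ξs Is - h ξ I) *
    (I + Is) ^ α * ‖ξ - ξs‖ ^ β * (r * (1 - r)) ^ (δ / 2 - 1)

/-- The resonant linearized collision operator `L_r`. -/
def Lr (m kB δ n Ttr Tint α β Cr : ℝ) (u : V3) (h : V3 → ℝ → ℝ) (ξ : V3) (I : ℝ) : ℝ :=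
  -Cr * ∫ Is in Set.Ici (0 : ℝ), ∫ ξs : V3,
    (∫ σ : Sph, (∫ r in Set.Icc (0 : ℝ) 1,
      LrIntegrand m kB δ n Ttr Tint α β u h ξ I Is ξs σ r) ∂sphMeasure)

/-- The product measure for the full 7-variable integrand of `Q_s`-moments:
variables `(ξ, I, ξ_*, I_*, σ, r, R)`. -/
def stdMeasure : Measure (V3 × ℝ × V3 × ℝ × Sph × ℝ × ℝ) :=
  (volume : Measure V3).prod
    (((volume : Measure ℝ).restrict (Set.Ici 0)).prod
      ((volume : Measure V3).prod
        (((volume : Measure ℝ).restrict (Set.Ici 0)).prod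
          (sphMeasure.prod
            (((volume : Measure ℝ).restrict (Set.Icc 0 1)).prod
              ((volume : Measure ℝ).restrict (Set.Icc 0 1)))))))

/-- The product measure for the full 6-variable integrand of `Q_r`-moments:
variables `(ξ, I, ξ_*, I_*, σ, r)`. -/
def resMeasure : Measure (V3 × ℝ × V3 × ℝ × Sph × ℝ) :=
  (volume : Measure V3).prod
    (((volume : Measure ℝ).restrict (Set.Ici 0)).prod
      ((volume : Measure V3).prod
        (((volume : Measure ℝ).restrict (Set.Ici 0)).prod
          (sphMeasure.prod ((volume : Measure ℝ).restrict (Set.Icc 0 1))))))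

/-- The product measure for the kernel variables `(I_*, ξ_*, σ, r)` of `L_r`. -/
def resKernelMeasure : Measure (ℝ × V3 × Sph × ℝ) :=
  ((volume : Measure ℝ).restrict (Set.Ici 0)).prod
    ((volume : Measure V3).prod (sphMeasure.prod ((volume : Measure ℝ).restrict (Set.Icc 0 1))))

open scoped ENNReal

/-- Barycentric change of variables `(x, y) = (tE, (1-t)E)` on the open quadrant. -/
lemma lintegral_Ici_Ici_eq_lintegral_simplex {k : ℝ → ℝ → ℝ≥0∞}
    (hk : Measurable (Function.uncurry k)) :
    ∫⁻ x in Set.Ici (0 : ℝ), ∫⁻ y in Set.Ici (0 : ℝ), k x y =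
      ∫⁻ E in Set.Ici (0 : ℝ), ∫⁻ t in Set.Icc (0 : ℝ) 1,
        ENNReal.ofReal E * k (t * E) ((1 - t) * E) := by
  have hIci : (volume : Measure ℝ).restrict (Set.Ici 0) = volume.restrict (Set.Ioi 0) :=
    Measure.restrict_congr_set Ioi_ae_eq_Ici.symm
  have hIcc : (volume : Measure ℝ).restrict (Set.Icc 0 1) = volume.restrict (Set.Ioo 0 1) :=
    Measure.restrict_congr_set Ioo_ae_eq_Icc.symm
  rw [hIci, hIcc]
  have shift (x : ℝ) : ∫⁻ y in Set.Ioi (0 : ℝ), k x y =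
      ∫⁻ E, (Set.Ioi x).indicator (fun E => k x (E - x)) E := by
    rw [← lintegral_indicator measurableSet_Ioi,
      ← lintegral_sub_right_eq_self ((Set.Ioi (0 : ℝ)).indicator fun y => k x y) x]
    refine lintegral_congr fun E => ?_
    by_cases h : x < E <;> simp [Set.indicator, h]
  simp_rw [shift]
  rw [lintegral_lintegral_swap, ← lintegral_indicator measurableSet_Ioi]
  · refine lintegral_congr fun E => ?_
    by_cases hE : 0 < E
    · have himg : (fun t : ℝ => t * E) '' Set.Ioo 0 1 = Set.Ioo 0 E := by
        rw [Set.image_mul_right_Ioo _ _ hE]; simp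
      have hset : ∫⁻ x in Set.Ioi (0 : ℝ), (Set.Ioi x).indicator (fun E => k x (E - x)) E =
          ∫⁻ x in Set.Ioo 0 E, k x (E - x) := by
        rw [← lintegral_indicator measurableSet_Ioi, ← lintegral_indicator measurableSet_Ioo]
        refine lintegral_congr fun x => ?_
        by_cases h0 : 0 < x <;> by_cases h : x < E <;> simp [Set.indicator, h0, h]
      rw [hset, ← himg, lintegral_image_eq_lintegral_abs_deriv_mul (f' := fun _ => E)
        measurableSet_Ioo (fun x _ => by simpa using (hasDerivAt_id x).mul_const E |>.hasDerivWithinAt)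
        (fun x _ y _ h => mul_right_cancel₀ hE.ne' h)]
      simp only [Set.mem_Ioi, hE, Set.indicator_of_mem, abs_of_pos]
      refine lintegral_congr fun t => ?_
      rw [sub_mul, one_mul]
    · rw [Set.indicator_of_notMem (by simpa using hE)]
      refine (setLIntegral_congr_fun measurableSet_Ioi fun x (hx : 0 < x) => ?_).trans
        lintegral_zero
      exact Set.indicator_of_notMem (by simp; linarith) _
  · apply Measurable.aemeasurable
    have : Function.uncurry (fun x E : ℝ => (Set.Ioi x).indicator (fun E => k x (E - x)) E) =
        {p : ℝ × ℝ | p.1 < p.2}.indicator fun p => k p.1 (p.2 - p.1) := by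
      ext ⟨x, E⟩; simp [Set.indicator]
    rw [this]
    exact (hk.comp (by fun_prop : Measurable fun p : ℝ × ℝ => (p.1, p.2 - p.1))).indicator
      (measurableSet_lt measurable_fst measurable_snd)

instance : IsFiniteMeasure sphMeasure :=
  inferInstanceAs (IsFiniteMeasure (volume : Measure V3).toSphere)

/-- Polar coordinates in `ℝ³`. -/
lemma lintegral_eq_lintegral_sphere_radius {h : V3 → ℝ≥0∞} (hh : Measurable h) :
    ∫⁻ g : V3, h g = ∫⁻ σ : Sph, (∫⁻ ρ in Set.Ioi (0 : ℝ),
      ENNReal.ofReal (ρ ^ 2) * h (ρ • (σ : V3))) ∂sphMeasure := by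
  have hd : Module.finrank ℝ V3 - 1 = 2 := by simp
  have hmp := (volume : Measure V3).measurePreserving_homeomorphUnitSphereProd
  rw [hd] at hmp
  have h1 : ∫⁻ g : V3, h g =
      ∫⁻ x : ({(0)}ᶜ : Set V3), h x ∂(Measure.comap (↑) (volume : Measure V3)) := by
    rw [lintegral_subtype_comap (measurableSet_singleton _).compl, restrict_compl_singleton]
  have hmeas : Measurable fun p : Sph × Set.Ioi (0 : ℝ) => h ((p.2 : ℝ) • (p.1 : V3)) := by
    fun_prop
  have h2 : ∫⁻ x : ({(0)}ᶜ : Set V3), h x ∂(Measure.comap (↑) (volume : Measure V3)) =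
      ∫⁻ p : Sph × Set.Ioi (0 : ℝ), h ((p.2 : ℝ) • (p.1 : V3))
        ∂(sphMeasure.prod (Measure.volumeIoiPow 2)) := by
    rw [sphMeasure, ← hmp.lintegral_comp hmeas]
    refine lintegral_congr fun x => ?_
    have hx : ‖(x : V3)‖ ≠ 0 := norm_ne_zero_iff.2 x.2
    simp [smul_smul, hx]
  rw [h1, h2, lintegral_prod _ hmeas.aemeasurable]
  refine lintegral_congr fun σ => ?_
  rw [Measure.volumeIoiPow, lintegral_withDensity_eq_lintegral_mul _ (by fun_prop) (by fun_prop)]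
  exact lintegral_subtype_comap measurableSet_Ioi
    (fun ρ : ℝ => ENNReal.ofReal (ρ ^ 2) * h (ρ • (σ : V3)))

/-- Polar coordinates in `ℝ³`, with the kinetic energy `a = m ρ² / 4` as radial variable. -/
lemma lintegral_eq_lintegral_sphere_energy {m : ℝ} (hm : 0 < m) {h : V3 → ℝ≥0∞}
    (hh : Measurable h) :
    ∫⁻ g : V3, h g = ∫⁻ σ : Sph, (∫⁻ a in Set.Ici (0 : ℝ),
      ENNReal.ofReal (4 / m * √(a / m)) * h ((2 * √(a / m)) • (σ : V3))) ∂sphMeasure := by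
  rw [lintegral_eq_lintegral_sphere_radius hh,
    Measure.restrict_congr_set (Ioi_ae_eq_Ici (μ := volume)).symm]
  refine lintegral_congr fun σ => ?_
  have himg : (fun a : ℝ => 2 * √(a / m)) '' Set.Ioi 0 = Set.Ioi 0 := by
    ext ρ
    constructor
    · rintro ⟨a, ha, rfl⟩
      have : 0 < a / m := div_pos ha hm
      exact mul_pos two_pos (Real.sqrt_pos.2 this)
    · intro (hρ : 0 < ρ)
      refine ⟨m * (ρ / 2) ^ 2, by simp only [Set.mem_Ioi]; positivity, ?_⟩
      simp only
      rw [mul_div_cancel_left₀ _ hm.ne', Real.sqrt_sq (by positivity)]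
      ring
  conv_lhs => rw [← himg]
  rw [lintegral_image_eq_lintegral_abs_deriv_mul
    (f' := fun a => 2 * (1 / m / (2 * √(a / m)))) measurableSet_Ioi]
  · refine setLIntegral_congr_fun measurableSet_Ioi fun a (ha : 0 < a) => ?_
    have h0 : 0 < a / m := div_pos ha hm
    have h1 : 0 < √(a / m) := Real.sqrt_pos.2 h0
    rw [← mul_assoc, ← ENNReal.ofReal_mul (abs_nonneg _), abs_of_pos (by positivity)]
    congr 2
    field_simp
    norm_num
  · intro a (ha : 0 < a)
    have h0 : a / m ≠ 0 := (div_pos ha hm).ne'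
    exact (((hasDerivAt_id a).div_const m).sqrt h0).const_mul 2 |>.hasDerivWithinAt
  · intro a (ha : 0 < a) b (hb : 0 < b) hab
    have := (Real.sqrt_inj (div_pos ha hm).le (div_pos hb hm).le).1
      (mul_left_cancel₀ two_ne_zero hab)
    field_simp at this
    exact this

/-- The measure `dσ dr dR` on the collision parameters `(σ, r, R)`. -/
def paramMeasure : Measure (Sph × ℝ × ℝ) :=
  sphMeasure.prod (((volume : Measure ℝ).restrict (Set.Icc 0 1)).prod
    ((volume : Measure ℝ).restrict (Set.Icc 0 1)))

instance : IsFiniteMeasure paramMeasure := by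
  unfold paramMeasure; infer_instance

/-- Relative velocity and internal energies of two molecules with total energy `E` in the
center-of-mass frame and collision parameters `ω = (σ, r, R)`. -/
def relState (m E : ℝ) (ω : Sph × ℝ × ℝ) : V3 × ℝ × ℝ :=
  ((2 * √(ω.2.2 * E / m)) • (ω.1 : V3), ω.2.1 * (1 - ω.2.2) * E, (1 - ω.2.1) * (1 - ω.2.2) * E)

/-- Total energy of a relative state `(g, I, I_*)`. -/
def relEnergy (m : ℝ) (s : V3 × ℝ × ℝ) : ℝ := m / 4 * ‖s.1‖ ^ 2 + s.2.1 + s.2.2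

/-- Density of the collision parameters preserved by collisions. -/
def paramWeight (ω : Sph × ℝ × ℝ) : ℝ≥0∞ := ENNReal.ofReal ((1 - ω.2.2) * √ω.2.2)

@[fun_prop]
lemma measurable_paramWeight : Measurable paramWeight := by
  unfold paramWeight; fun_prop

@[fun_prop]
lemma measurable_relEnergy (m : ℝ) : Measurable (relEnergy m) := by
  unfold relEnergy; fun_prop

lemma measurable_relState (m : ℝ) :
    Measurable fun p : ℝ × Sph × ℝ × ℝ => relState m p.1 p.2 := by
  unfold relState; fun_prop

lemma lintegral_paramWeight_lt_top : ∫⁻ ω, paramWeight ω ∂paramMeasure < ∞ := by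
  refine (lintegral_mono_ae (g := fun _ => 1) ?_).trans_lt (by simp)
  have hI : ∀ᵐ R ∂(volume : Measure ℝ).restrict (Set.Icc 0 1), R ∈ Set.Icc (0 : ℝ) 1 :=
    ae_restrict_mem measurableSet_Icc
  have : ∀ᵐ ω ∂paramMeasure, ω.2.2 ∈ Set.Icc (0 : ℝ) 1 :=
    (Measure.quasiMeasurePreserving_snd.comp Measure.quasiMeasurePreserving_snd).ae hI
  filter_upwards [this] with ω hω
  rw [paramWeight, ENNReal.ofReal_le_one]
  exact mul_le_one₀ (by linarith [hω.1]) (Real.sqrt_nonneg _) (Real.sqrt_le_one.2 hω.2)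

lemma relEnergy_relState {m E : ℝ} (hm : 0 < m) (hE : 0 ≤ E) {ω : Sph × ℝ × ℝ}
    (hω : 0 ≤ ω.2.2) : relEnergy m (relState m E ω) = E := by
  have h0 : 0 ≤ ω.2.2 * E / m := by positivity
  have h1 : ‖(ω.1 : V3)‖ = 1 := by simp
  simp only [relEnergy, relState, norm_smul, h1, mul_one, norm_mul, Real.norm_eq_abs, mul_pow,
    sq_abs, Real.sq_sqrt h0]
  field_simp
  ring

/-- Disintegration of `dg dI dI_*` along the total energy. -/
lemma lintegral_relState {m : ℝ} (hm : 0 < m) {Ψ : V3 × ℝ × ℝ → ℝ≥0∞} (hΨ : Measurable Ψ) :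
    ∫⁻ g : V3, ∫⁻ I in Set.Ici (0 : ℝ), ∫⁻ Is in Set.Ici (0 : ℝ), Ψ (g, I, Is) =
      ∫⁻ E in Set.Ici (0 : ℝ), ENNReal.ofReal (4 / m * (E ^ 2 * √(E / m))) *
        ∫⁻ ω, paramWeight ω * Ψ (relState m E ω) ∂paramMeasure := by
  have simplex (g : V3) : ∫⁻ I in Set.Ici (0 : ℝ), ∫⁻ Is in Set.Ici (0 : ℝ), Ψ (g, I, Is) =
      ∫⁻ b in Set.Ici (0 : ℝ), ∫⁻ r in Set.Icc (0 : ℝ) 1,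
        ENNReal.ofReal b * Ψ (g, r * b, (1 - r) * b) :=
    lintegral_Ici_Ici_eq_lintegral_simplex (k := fun I Is => Ψ (g, I, Is)) (by fun_prop)
  have m1 : Measurable fun p : V3 × ℝ => ∫⁻ r in Set.Icc (0 : ℝ) 1,
        ENNReal.ofReal p.2 * Ψ (p.1, r * p.2, (1 - r) * p.2) :=
    Measurable.lintegral_prod_right' (f := fun q : (V3 × ℝ) × ℝ =>
      ENNReal.ofReal q.1.2 * Ψ (q.1.1, q.2 * q.1.2, (1 - q.2) * q.1.2)) (by fun_prop)
  simp_rw [simplex]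
  rw [lintegral_eq_lintegral_sphere_energy hm m1.lintegral_prod_right']
  have energy (σ : Sph) : ∫⁻ a in Set.Ici (0 : ℝ), ENNReal.ofReal (4 / m * √(a / m)) *
        ∫⁻ b in Set.Ici (0 : ℝ), ∫⁻ r in Set.Icc (0 : ℝ) 1,
          ENNReal.ofReal b * Ψ ((2 * √(a / m)) • (σ : V3), r * b, (1 - r) * b) =
      ∫⁻ E in Set.Ici (0 : ℝ), ∫⁻ R in Set.Icc (0 : ℝ) 1, ∫⁻ r in Set.Icc (0 : ℝ) 1,
        ENNReal.ofReal (4 / m * (E ^ 2 * √(E / m))) * (paramWeight (σ, r, R) *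
          Ψ (relState m E (σ, r, R))) := by
    have m2 : Measurable fun p : ℝ × ℝ => ∫⁻ r in Set.Icc (0 : ℝ) 1,
        ENNReal.ofReal p.2 * Ψ ((2 * √(p.1 / m)) • (σ : V3), r * p.2, (1 - r) * p.2) :=
      m1.comp (by fun_prop : Measurable fun p : ℝ × ℝ => ((2 * √(p.1 / m)) • (σ : V3), p.2))
    have pull (a : ℝ) : ENNReal.ofReal (4 / m * √(a / m)) *
        ∫⁻ b in Set.Ici (0 : ℝ), ∫⁻ r in Set.Icc (0 : ℝ) 1,
          ENNReal.ofReal b * Ψ ((2 * √(a / m)) • (σ : V3), r * b, (1 - r) * b) =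
        ∫⁻ b in Set.Ici (0 : ℝ), ENNReal.ofReal (4 / m * √(a / m)) *
          ∫⁻ r in Set.Icc (0 : ℝ) 1,
            ENNReal.ofReal b * Ψ ((2 * √(a / m)) • (σ : V3), r * b, (1 - r) * b) :=
      (lintegral_const_mul _ (m2.comp (by fun_prop : Measurable fun b : ℝ => (a, b)))).symm
    simp_rw [pull]
    rw [lintegral_Ici_Ici_eq_lintegral_simplex (by
      simp only [Function.uncurry_def]
      exact (by fun_prop : Measurable fun p : ℝ × ℝ =>
        ENNReal.ofReal (4 / m * √(p.1 / m))).mul m2)]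
    refine setLIntegral_congr_fun measurableSet_Ici fun E (hE : 0 ≤ E) => ?_
    refine setLIntegral_congr_fun measurableSet_Icc fun R hR => ?_
    have h1R : 0 ≤ 1 - R := by linarith [hR.2]
    rw [← mul_assoc, ← ENNReal.ofReal_mul hE, ← lintegral_const_mul _ (by fun_prop)]
    refine lintegral_congr fun r => ?_
    simp only [paramWeight]
    rw [← mul_assoc, ← mul_assoc (ENNReal.ofReal (4 / m * (E ^ 2 * √(E / m)))),
      ← ENNReal.ofReal_mul (by positivity), ← ENNReal.ofReal_mul (by positivity)]
    congr 2
    · rw [mul_div_assoc R E m, Real.sqrt_mul hR.1]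
      ring
    · simp only [relState, mul_assoc]
  simp_rw [energy]
  have hst := measurable_relState m
  rw [lintegral_lintegral_swap]
  · refine setLIntegral_congr_fun measurableSet_Ici fun E _ => ?_
    have m3 : Measurable fun ω : Sph × ℝ × ℝ => paramWeight ω * Ψ (relState m E ω) :=
      measurable_paramWeight.mul
        (hΨ.comp (hst.comp (by fun_prop : Measurable fun ω : Sph × ℝ × ℝ => (E, ω))))
    rw [← lintegral_const_mul _ m3, paramMeasure, lintegral_prod _ (by fun_prop)]
    refine lintegral_congr fun σ => ?_
    rw [lintegral_prod_symm' _ (by fun_prop)]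
  · apply Measurable.aemeasurable
    have m4 : Measurable fun p : (((Sph × ℝ) × ℝ) × ℝ) =>
        ENNReal.ofReal (4 / m * (p.1.1.2 ^ 2 * √(p.1.1.2 / m))) *
          (paramWeight (p.1.1.1, p.2, p.1.2) * Ψ (relState m p.1.1.2 (p.1.1.1, p.2, p.1.2))) := by
      have := hst.comp (by fun_prop : Measurable fun p : (((Sph × ℝ) × ℝ) × ℝ) =>
        (p.1.1.2, p.1.1.1, p.2, p.1.2))
      exact (by fun_prop : Measurable fun p : (((Sph × ℝ) × ℝ) × ℝ) =>
        ENNReal.ofReal (4 / m * (p.1.1.2 ^ 2 * √(p.1.1.2 / m)))).mul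
        ((measurable_paramWeight.comp (by fun_prop)).mul (hΨ.comp this))
    exact m4.lintegral_prod_right'.lintegral_prod_right'

/-- Collisions preserve `dg dI dI_*` once the collision parameters are averaged out. -/
lemma lintegral_collision_rel {m : ℝ} (hm : 0 < m) {Ψ : V3 × ℝ × ℝ → ℝ≥0∞}
    (hΨ : Measurable Ψ) :
    ∫⁻ g : V3, ∫⁻ I in Set.Ici (0 : ℝ), ∫⁻ Is in Set.Ici (0 : ℝ),
        ∫⁻ ω, paramWeight ω * Ψ (relState m (relEnergy m (g, I, Is)) ω) ∂paramMeasure =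
      (∫⁻ ω, paramWeight ω ∂paramMeasure) *
        ∫⁻ g : V3, ∫⁻ I in Set.Ici (0 : ℝ), ∫⁻ Is in Set.Ici (0 : ℝ), Ψ (g, I, Is) := by
  have hst := measurable_relState m
  have hJ : Measurable fun E : ℝ => ∫⁻ ω, paramWeight ω * Ψ (relState m E ω) ∂paramMeasure :=
    Measurable.lintegral_prod_right' (f := fun p : ℝ × Sph × ℝ × ℝ =>
      paramWeight p.2 * Ψ (relState m p.1 p.2))
      ((measurable_paramWeight.comp measurable_snd).mul (hΨ.comp hst))
  rw [lintegral_relState hm hΨ, lintegral_relState hm (Ψ := fun s =>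
    ∫⁻ ω, paramWeight ω * Ψ (relState m (relEnergy m s) ω) ∂paramMeasure)
    (hJ.comp (measurable_relEnergy m)), ← lintegral_const_mul _ (by fun_prop)]
  refine setLIntegral_congr_fun measurableSet_Ici fun E (hE : 0 ≤ E) => ?_
  have hR : ∀ᵐ ω ∂paramMeasure, ω.2.2 ∈ Set.Icc (0 : ℝ) 1 :=
    (Measure.quasiMeasurePreserving_snd.comp Measure.quasiMeasurePreserving_snd).ae
      (ae_restrict_mem measurableSet_Icc)
  rw [lintegral_congr_ae (g := fun ω => paramWeight ω *
    ∫⁻ ω, paramWeight ω * Ψ (relState m E ω) ∂paramMeasure)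
    (by filter_upwards [hR] with ω hω; rw [relEnergy_relState hm hE hω.1]),
    lintegral_mul_const _ measurable_paramWeight]
  ring

/-- Passage from velocities to center-of-mass and relative velocities. -/
lemma lintegral_centerOfMass {F : V3 × V3 → ℝ≥0∞} (hF : Measurable F) :
    ∫⁻ ξ : V3, ∫⁻ ξs : V3, F (ξ, ξs) =
      ∫⁻ v : V3, ∫⁻ g : V3, F (v + (1 / 2 : ℝ) • g, v - (1 / 2 : ℝ) • g) := by
  have h1 (ξ : V3) : ∫⁻ ξs : V3, F (ξ, ξs) = ∫⁻ g : V3, F (ξ, ξ - g) :=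
    (lintegral_sub_left_eq_self (fun ξs => F (ξ, ξs)) ξ).symm
  simp_rw [h1]
  rw [lintegral_lintegral_swap (by
      simp only [Function.uncurry_def]
      exact (by fun_prop : Measurable _).aemeasurable),
    lintegral_lintegral_swap (f := fun v g : V3 =>
      F (v + (1 / 2 : ℝ) • g, v - (1 / 2 : ℝ) • g)) (by
      simp only [Function.uncurry_def]
      exact (by fun_prop : Measurable _).aemeasurable)]
  refine lintegral_congr fun g => ?_
  rw [← lintegral_add_right_eq_self (fun ξ => F (ξ, ξ - g)) ((1 / 2 : ℝ) • g)]
  refine lintegral_congr fun v => ?_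
  congr 2
  module

instance : SFinite phaseMeasure := by
  unfold phaseMeasure; infer_instance

/-- The pair of molecules with center-of-mass velocity `v` and relative state `s`. -/
def pairOfRel (v : V3) (s : V3 × ℝ × ℝ) : (V3 × ℝ) × (V3 × ℝ) :=
  ((v + (1 / 2 : ℝ) • s.1, s.2.1), (v - (1 / 2 : ℝ) • s.1, s.2.2))

/-- The post-collisional pair. -/
def collide (m : ℝ) (p q : V3 × ℝ) (ω : Sph × ℝ × ℝ) : (V3 × ℝ) × (V3 × ℝ) :=
  ((xiPrimeStd m p.1 q.1 p.2 q.2 ω.2.2 ω.1, IPrimeStd m p.1 q.1 p.2 q.2 ω.2.2 ω.2.1),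
    (xiStarPrimeStd m p.1 q.1 p.2 q.2 ω.2.2 ω.1, IStarPrimeStd m p.1 q.1 p.2 q.2 ω.2.2 ω.2.1))

lemma measurable_pairOfRel :
    Measurable fun x : V3 × V3 × ℝ × ℝ => pairOfRel x.1 x.2 := by
  unfold pairOfRel; fun_prop

lemma measurable_collide (m : ℝ) :
    Measurable fun x : ((V3 × ℝ) × (V3 × ℝ)) × (Sph × ℝ × ℝ) => collide m x.1.1 x.1.2 x.2 := by
  unfold collide xiPrimeStd xiStarPrimeStd IPrimeStd IStarPrimeStd collE; fun_prop

lemma collide_pairOfRel (m : ℝ) (v : V3) (s : V3 × ℝ × ℝ) (ω : Sph × ℝ × ℝ) :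
    collide m (pairOfRel v s).1 (pairOfRel v s).2 ω =
      pairOfRel v (relState m (relEnergy m s) ω) := by
  have hg : v + (1 / 2 : ℝ) • s.1 - (v - (1 / 2 : ℝ) • s.1) = s.1 := by module
  have hv : (1 / 2 : ℝ) • (v + (1 / 2 : ℝ) • s.1 + (v - (1 / 2 : ℝ) • s.1)) = v := by module
  simp only [collide, pairOfRel, relState, relEnergy, xiPrimeStd, xiStarPrimeStd, IPrimeStd,
    IStarPrimeStd, collE, hg, hv, smul_smul]
  ring_nf

lemma lintegral_phase_pair {H : (V3 × ℝ) × (V3 × ℝ) → ℝ≥0∞} (hH : Measurable H) :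
    ∫⁻ p, ∫⁻ q, H (p, q) ∂phaseMeasure ∂phaseMeasure =
      ∫⁻ v : V3, ∫⁻ g : V3, ∫⁻ I in Set.Ici (0 : ℝ), ∫⁻ Is in Set.Ici (0 : ℝ),
        H (pairOfRel v (g, I, Is)) := by
  have hq (p : V3 × ℝ) : ∫⁻ q, H (p, q) ∂phaseMeasure =
      ∫⁻ ξs : V3, ∫⁻ Is in Set.Ici (0 : ℝ), H (p, (ξs, Is)) := by
    rw [phaseMeasure, lintegral_prod _ (by fun_prop)]
  have m1 : Measurable fun x : (V3 × ℝ) × V3 => ∫⁻ Is in Set.Ici (0 : ℝ), H (x.1, (x.2, Is)) :=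
    Measurable.lintegral_prod_right' (f := fun y : ((V3 × ℝ) × V3) × ℝ =>
      H (y.1.1, (y.1.2, y.2))) (by fun_prop)
  have m2 : Measurable fun x : (V3 × V3) × ℝ =>
      ∫⁻ Is in Set.Ici (0 : ℝ), H ((x.1.1, x.2), (x.1.2, Is)) :=
    m1.comp (by fun_prop : Measurable fun x : (V3 × V3) × ℝ => ((x.1.1, x.2), x.1.2))
  simp_rw [hq]
  rw [phaseMeasure, lintegral_prod _ m1.lintegral_prod_right'.aemeasurable]
  have hswap (ξ : V3) : ∫⁻ I in Set.Ici (0 : ℝ), ∫⁻ ξs : V3, ∫⁻ Is in Set.Ici (0 : ℝ),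
      H ((ξ, I), (ξs, Is)) = ∫⁻ ξs : V3, ∫⁻ I in Set.Ici (0 : ℝ), ∫⁻ Is in Set.Ici (0 : ℝ),
      H ((ξ, I), (ξs, Is)) :=
    lintegral_lintegral_swap
      (m1.comp (by fun_prop : Measurable fun x : ℝ × V3 => ((ξ, x.1), x.2))).aemeasurable
  simp_rw [hswap]
  exact lintegral_centerOfMass (F := fun x : V3 × V3 => ∫⁻ I in Set.Ici (0 : ℝ),
    ∫⁻ Is in Set.Ici (0 : ℝ), H ((x.1, I), (x.2, Is))) m2.lintegral_prod_right'

/-- Collisions preserve the measure `dξ dI dξ_* dI_*` once the collision parameters are averaged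
out. -/
lemma lintegral_collide {m : ℝ} (hm : 0 < m) {Φ : (V3 × ℝ) × (V3 × ℝ) → ℝ≥0∞}
    (hΦ : Measurable Φ) :
    ∫⁻ p, ∫⁻ q, ∫⁻ ω, paramWeight ω * Φ (collide m p q ω) ∂paramMeasure
        ∂phaseMeasure ∂phaseMeasure =
      (∫⁻ ω, paramWeight ω ∂paramMeasure) *
        ∫⁻ p, ∫⁻ q, Φ (p, q) ∂phaseMeasure ∂phaseMeasure := by
  have hL : Measurable fun x : (V3 × ℝ) × (V3 × ℝ) =>
      ∫⁻ ω, paramWeight ω * Φ (collide m x.1 x.2 ω) ∂paramMeasure :=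
    Measurable.lintegral_prod_right' (f := fun x : ((V3 × ℝ) × (V3 × ℝ)) × (Sph × ℝ × ℝ) =>
      paramWeight x.2 * Φ (collide m x.1.1 x.1.2 x.2))
      ((measurable_paramWeight.comp measurable_snd).mul (hΦ.comp (measurable_collide m)))
  have hpair := measurable_pairOfRel
  have hv (v : V3) : Measurable fun s : V3 × ℝ × ℝ => Φ (pairOfRel v s) :=
    hΦ.comp (hpair.comp (by fun_prop : Measurable fun s : V3 × ℝ × ℝ => (v, s)))
  have m1 : Measurable fun x : ((V3 × V3) × ℝ) × ℝ =>
      Φ (pairOfRel x.1.1.1 (x.1.1.2, x.1.2, x.2)) :=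
    hΦ.comp (hpair.comp (by fun_prop : Measurable fun x : ((V3 × V3) × ℝ) × ℝ =>
      (x.1.1.1, x.1.1.2, x.1.2, x.2)))
  rw [lintegral_phase_pair hL, lintegral_phase_pair hΦ, ← lintegral_const_mul _
    m1.lintegral_prod_right'.lintegral_prod_right'.lintegral_prod_right']
  refine lintegral_congr fun v => ?_
  simp_rw [collide_pairOfRel]
  exact lintegral_collision_rel hm (Ψ := fun s => Φ (pairOfRel v s)) (hv v)

/-- Exponent of the two-temperature equilibrium distribution. -/
def MrExponent (m kB Ttr Tint : ℝ) (u : V3) (p : V3 × ℝ) : ℝ :=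
  m * ‖p.1 - u‖ ^ 2 / (2 * kB * Ttr) + p.2 / (kB * Tint)

/-- The equilibrium distribution with a fraction `s` of its exponential decay removed. -/
def MrTilted (m kB δ n Ttr Tint : ℝ) (u : V3) (s : ℝ) (p : V3 × ℝ) : ℝ :=
  Mr m kB δ n Ttr Tint u p.1 p.2 * Real.exp (s * MrExponent m kB Ttr Tint u p)

lemma measurable_Mr (m kB δ n Ttr Tint : ℝ) (u : V3) :
    Measurable fun p : V3 × ℝ => Mr m kB δ n Ttr Tint u p.1 p.2 := by
  unfold Mr; fun_prop

lemma measurable_MrTilted (m kB δ n Ttr Tint : ℝ) (u : V3) (s : ℝ) :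
    Measurable (MrTilted m kB δ n Ttr Tint u s) := by
  unfold MrTilted MrExponent
  exact (measurable_Mr m kB δ n Ttr Tint u).mul (by fun_prop)

lemma Mr_nonneg {m kB δ n Ttr Tint : ℝ} (hm : 0 < m) (hkB : 0 < kB) (hδ : 2 ≤ δ) (hn : 0 < n)
    (hTtr : 0 < Ttr) (hTint : 0 < Tint) (u ξ : V3) {I : ℝ} (hI : 0 ≤ I) :
    0 ≤ Mr m kB δ n Ttr Tint u ξ I := by
  have := Real.Gamma_pos_of_pos (show 0 < δ / 2 by linarith)
  unfold Mr
  positivity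

lemma integrable_exp_neg_mul_norm_sub_sq {b : ℝ} (hb : 0 < b) (u : V3) :
    Integrable fun ξ : V3 => Real.exp (-b * ‖ξ - u‖ ^ 2) := by
  have h := (GaussianFourier.integrable_cexp_neg_mul_sq_norm_add (V := V3) (b := (b : ℂ))
    (by simpa) 0 0).norm
  have h' : Integrable fun ξ : V3 => Real.exp (-b * ‖ξ‖ ^ 2) := by
    refine h.congr (.of_forall fun ξ => ?_)
    simp only [Complex.norm_exp]
    congr 1
    simp [← Complex.ofReal_pow]
  exact h'.comp_sub_right u

lemma integrable_MrTilted {m kB δ n Ttr Tint : ℝ} (hm : 0 < m) (hkB : 0 < kB) (hδ : 2 ≤ δ)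
    (hTtr : 0 < Ttr) (hTint : 0 < Tint) (u : V3) {s : ℝ} (hs : s < 1) :
    Integrable (MrTilted m kB δ n Ttr Tint u s) phaseMeasure := by
  have hs' : 0 < 1 - s := by linarith
  have h1 := integrable_exp_neg_mul_norm_sub_sq
    (show 0 < (1 - s) * (m / (2 * kB * Ttr)) by positivity) u
  have h2 : IntegrableOn (fun I : ℝ => I ^ (δ / 2 - 1) *
      Real.exp (-((1 - s) / (kB * Tint)) * I ^ (1 : ℝ))) (Set.Ici 0) := by
    rw [integrableOn_Ici_iff_integrableOn_Ioi]
    exact integrableOn_rpow_mul_exp_neg_mul_rpow (by linarith) one_pos (by positivity)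
  refine ((h1.mul_prod h2).const_mul (n /
    ((2 * π * kB * Ttr / m) ^ ((3 : ℝ) / 2) * (kB * Tint) ^ (δ / 2) * Real.Gamma (δ / 2)))).congr
    (.of_forall fun p => ?_)
  simp only [MrTilted, Mr, MrExponent, Real.rpow_one]
  have e : Real.exp (-(m * ‖p.1 - u‖ ^ 2) / (2 * kB * Ttr) - p.2 / (kB * Tint)) *
      Real.exp (s * (m * ‖p.1 - u‖ ^ 2 / (2 * kB * Ttr) + p.2 / (kB * Tint))) =
      Real.exp (-((1 - s) * (m / (2 * kB * Ttr))) * ‖p.1 - u‖ ^ 2) *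
        Real.exp (-((1 - s) / (kB * Tint)) * p.2) := by
    rw [← Real.exp_add, ← Real.exp_add]
    congr 1
    ring
  rw [mul_assoc (n * _ / _), e]
  ring

/-- The exponents of two molecules control their energy in the center-of-mass frame. -/
lemma collE_le_MrExponent {m kB Ttr Tint : ℝ} (hm : 0 < m) (hkB : 0 < kB) (hTtr : 0 < Ttr)
    (hTint : 0 < Tint) (u : V3) {p q : V3 × ℝ} (hp : 0 ≤ p.2) (hq : 0 ≤ q.2) :
    collE m p.1 q.1 p.2 q.2 ≤
      kB * (Ttr + Tint) * (MrExponent m kB Ttr Tint u p + MrExponent m kB Ttr Tint u q) := by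
  have hpar : ‖p.1 - q.1‖ ^ 2 ≤ 2 * (‖p.1 - u‖ ^ 2 + ‖q.1 - u‖ ^ 2) := by
    have h := parallelogram_law_with_norm ℝ (p.1 - u) (q.1 - u)
    rw [sub_sub_sub_cancel_right] at h
    nlinarith [mul_self_nonneg ‖p.1 - u + (q.1 - u)‖]
  set a := ‖p.1 - u‖ ^ 2
  set b := ‖q.1 - u‖ ^ 2
  have ha : 0 ≤ a := by positivity
  have hb : 0 ≤ b := by positivity
  have expand : kB * (Ttr + Tint) *
      (MrExponent m kB Ttr Tint u p + MrExponent m kB Ttr Tint u q) =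
      m / 2 * (a + b) + (p.2 + q.2) + Tint / Ttr * (m / 2 * (a + b)) +
        Ttr / Tint * (p.2 + q.2) := by
    simp only [MrExponent, a, b]
    field_simp
    ring
  have h1 : 0 ≤ Tint / Ttr * (m / 2 * (a + b)) := by positivity
  have h2 : 0 ≤ Ttr / Tint * (p.2 + q.2) := by positivity
  rw [expand, collE]
  nlinarith

/-- Powers are dominated by exponentials. -/
lemma exists_rpow_le_mul_exp {b : ℝ} (hb : 0 < b) (s : ℝ) (hs : 0 ≤ s) :
    ∃ C : ℝ, 0 < C ∧ ∀ x : ℝ, 0 ≤ x → x ^ s ≤ C * Real.exp (b * x) := by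
  obtain ⟨k, hk⟩ := exists_nat_ge s
  refine ⟨1 + k.factorial / b ^ k, by positivity, fun x hx => ?_⟩
  have h1 : x ^ s ≤ 1 + x ^ k := by
    rcases le_total x 1 with h | h
    · have := Real.rpow_le_one hx h hs
      have : 0 ≤ x ^ k := by positivity
      linarith
    · have := Real.rpow_le_rpow_of_exponent_le h hk
      rw [Real.rpow_natCast] at this
      linarith
  have h2 := Real.pow_div_factorial_le_exp (b * x) (by positivity) k
  have h3 : x ^ k ≤ k.factorial / b ^ k * Real.exp (b * x) := by
    rw [mul_pow, div_le_iff₀ (by positivity)] at h2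
    rw [div_mul_eq_mul_div, le_div_iff₀ (by positivity)]
    linarith
  have h4 : 1 ≤ Real.exp (b * x) := Real.one_le_exp (by positivity)
  linarith

/-- Powers of the energy are absorbed in the decay of the equilibrium distribution. -/
lemma exists_collE_rpow_mul_Mr_le {m kB Ttr Tint : ℝ} (hm : 0 < m) (hkB : 0 < kB)
    (hTtr : 0 < Ttr) (hTint : 0 < Tint) (δ n : ℝ) (u : V3) {s : ℝ} (hs : 0 ≤ s) :
    ∃ C : ℝ, 0 < C ∧ ∀ p q : V3 × ℝ, 0 ≤ p.2 → 0 ≤ q.2 →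
      collE m p.1 q.1 p.2 q.2 ^ s *
          (|Mr m kB δ n Ttr Tint u p.1 p.2| * |Mr m kB δ n Ttr Tint u q.1 q.2|) ≤
        C * (|MrTilted m kB δ n Ttr Tint u (1 / 4) p| *
          |MrTilted m kB δ n Ttr Tint u (1 / 4) q|) := by
  have hc : 0 < kB * (Ttr + Tint) := by positivity
  obtain ⟨C, hC, h⟩ := exists_rpow_le_mul_exp (b := 1 / (4 * (kB * (Ttr + Tint))))
    (by positivity) s hs
  refine ⟨C, hC, fun p q hp hq => ?_⟩
  have hE : 0 ≤ collE m p.1 q.1 p.2 q.2 := by unfold collE; positivity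
  have h1 := collE_le_MrExponent hm hkB hTtr hTint u hp hq
  set x := MrExponent m kB Ttr Tint u p with hx
  set y := MrExponent m kB Ttr Tint u q with hy
  have h2 : collE m p.1 q.1 p.2 q.2 ^ s ≤
      C * (Real.exp (1 / 4 * x) * Real.exp (1 / 4 * y)) := by
    refine (h _ hE).trans ?_
    rw [← Real.exp_add]
    gcongr
    rw [div_mul_eq_mul_div, div_le_iff₀ (by positivity)]
    linarith
  simp only [MrTilted, abs_mul, Real.abs_exp, ← hx, ← hy]
  calc _ ≤ C * (Real.exp (1 / 4 * x) * Real.exp (1 / 4 * y)) *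
      (|Mr m kB δ n Ttr Tint u p.1 p.2| * |Mr m kB δ n Ttr Tint u q.1 q.2|) := by gcongr
    _ = _ := by ring

lemma gain_kernel_le {δ α β E I Is r R : ℝ} (hδ : 2 ≤ δ) (hα : 0 ≤ α) (hβ : 0 ≤ β) (hI : 0 ≤ I)
    (hIs : 0 ≤ Is) (hE : I + Is ≤ E) (hr : r ∈ Set.Icc (0 : ℝ) 1) (hR : R ∈ Set.Icc (0 : ℝ) 1) :
    (I * Is) ^ (δ / 2 - 1) * (r * (1 - r)) ^ (δ / 2 - 1) * (1 - R) ^ (α + δ - 1) *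
        R ^ ((β + 1) / 2) / (r * (1 - R) * E * ((1 - r) * (1 - R) * E)) ^ (δ / 2 - 1) ≤
      (1 - R) * √R := by
  obtain ⟨hr0, hr1⟩ := hr
  obtain ⟨hR0, hR1⟩ := hR
  have hE0 : 0 ≤ E := by linarith
  have hr1' : 0 ≤ 1 - r := by linarith
  have hR1' : 0 ≤ 1 - R := by linarith
  have hd : 0 ≤ δ / 2 - 1 := by linarith
  have hII : (I * Is) ^ (δ / 2 - 1) ≤ (E * E) ^ (δ / 2 - 1) := by
    gcongr <;> linarith
  have hRβ : R ^ ((β + 1) / 2) ≤ √R := by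
    rw [Real.sqrt_eq_rpow]
    exact Real.rpow_le_rpow_of_exponent_ge_of_imp hR0 hR1 (by linarith) (by intros; linarith)
  have hRα : (1 - R) ^ (α + δ - 1) ≤ ((1 - R) * (1 - R)) ^ (δ / 2 - 1) * (1 - R) := by
    have e : α + δ - 1 = (δ / 2 - 1) + (δ / 2 - 1) + (α + 1) := by ring
    rw [e, Real.rpow_add_of_nonneg hR1' (by linarith) (by linarith),
      Real.rpow_add_of_nonneg hR1' hd hd, Real.mul_rpow hR1' hR1']
    gcongr
    calc (1 - R) ^ (α + 1) ≤ (1 - R) ^ (1 : ℝ) :=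
          Real.rpow_le_rpow_of_exponent_ge_of_imp hR1' (by linarith) (by linarith)
            (by intros; linarith)
      _ = 1 - R := Real.rpow_one _
  have hden : (r * (1 - R) * E * ((1 - r) * (1 - R) * E)) ^ (δ / 2 - 1) =
      (E * E) ^ (δ / 2 - 1) * (r * (1 - r)) ^ (δ / 2 - 1) *
        ((1 - R) * (1 - R)) ^ (δ / 2 - 1) := by
    rw [← Real.mul_rpow (by positivity) (by positivity),
      ← Real.mul_rpow (by positivity) (by positivity)]
    congr 1
    ring
  rw [hden]
  set D := (E * E) ^ (δ / 2 - 1) * (r * (1 - r)) ^ (δ / 2 - 1) *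
        ((1 - R) * (1 - R)) ^ (δ / 2 - 1) with hD
  calc _ ≤ (E * E) ^ (δ / 2 - 1) * (r * (1 - r)) ^ (δ / 2 - 1) *
        (((1 - R) * (1 - R)) ^ (δ / 2 - 1) * (1 - R)) * √R / D := by gcongr
    _ = D / D * ((1 - R) * √R) := by rw [hD]; ring
    _ ≤ 1 * ((1 - R) * √R) := by gcongr; exact div_self_le_one D
    _ = _ := one_mul _

lemma loss_kernel_le {δ α β r R : ℝ} (a : ℝ) (hδ : 2 ≤ δ) (hα : 0 ≤ α) (hβ : 0 ≤ β)
    (hr : r ∈ Set.Icc (0 : ℝ) 1) (hR : R ∈ Set.Icc (0 : ℝ) 1) :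
    a / a * (r * (1 - r)) ^ (δ / 2 - 1) * (1 - R) ^ (α + δ - 1) * R ^ ((β + 1) / 2) ≤ 1 := by
  obtain ⟨hr0, hr1⟩ := hr
  obtain ⟨hR0, hR1⟩ := hR
  have hr1' : 0 ≤ 1 - r := by linarith
  have hR1' : 0 ≤ 1 - R := by linarith
  have h1 : (r * (1 - r)) ^ (δ / 2 - 1) ≤ 1 :=
    Real.rpow_le_one (by positivity) (by nlinarith) (by linarith)
  have h2 : (1 - R) ^ (α + δ - 1) ≤ 1 := Real.rpow_le_one hR1' (by linarith) (by linarith)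
  have h3 : R ^ ((β + 1) / 2) ≤ 1 := Real.rpow_le_one hR0 hR1 (by linarith)
  calc _ ≤ 1 * 1 * 1 * (1 : ℝ) := by gcongr; exact div_self_le_one a
    _ = 1 := by ring

lemma mul_rpow_mul_norm_rpow_le {m α β I Is : ℝ} (hm : 0 < m) (hα : 0 ≤ α) (hβ : 0 ≤ β)
    (ξ ξs : V3) (hI : 0 ≤ I) (hIs : 0 ≤ Is) :
    I * (I + Is) ^ α * ‖ξ - ξs‖ ^ β ≤
      (4 / m) ^ (β / 2) * collE m ξ ξs I Is ^ (1 + α + β / 2) := by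
  set E := collE m ξ ξs I Is with hE
  have hg : 0 ≤ m / 4 * ‖ξ - ξs‖ ^ 2 := by positivity
  have hE1 : I + Is ≤ E := by rw [hE, collE]; linarith
  have hE0 : 0 ≤ E := by linarith
  have hg2 : ‖ξ - ξs‖ ^ 2 ≤ 4 / m * E := by
    rw [hE, collE, div_mul_eq_mul_div, le_div_iff₀ hm]; linarith
  have h1 : ‖ξ - ξs‖ ^ β ≤ (4 / m) ^ (β / 2) * E ^ (β / 2) := by
    rw [← Real.mul_rpow (by positivity) hE0]
    calc ‖ξ - ξs‖ ^ β = (‖ξ - ξs‖ ^ 2) ^ (β / 2) := by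
          rw [← Real.rpow_natCast, ← Real.rpow_mul (norm_nonneg _)]
          congr 1
          push_cast
          ring
      _ ≤ _ := by gcongr
  rw [Real.rpow_add_of_nonneg hE0 (by linarith) (by linarith),
    Real.rpow_add_of_nonneg hE0 zero_le_one hα, Real.rpow_one]
  calc I * (I + Is) ^ α * ‖ξ - ξs‖ ^ β
      ≤ E * E ^ α * ((4 / m) ^ (β / 2) * E ^ (β / 2)) := by gcongr; linarith
    _ = _ := by ring

lemma collE_collide {m : ℝ} (hm : 0 < m) {p q : V3 × ℝ} (hp : 0 ≤ p.2) (hq : 0 ≤ q.2)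
    {ω : Sph × ℝ × ℝ} (hR : 0 ≤ ω.2.2) :
    collE m (collide m p q ω).1.1 (collide m p q ω).2.1 (collide m p q ω).1.2
      (collide m p q ω).2.2 = collE m p.1 q.1 p.2 q.2 := by
  have hE : 0 ≤ collE m p.1 q.1 p.2 q.2 := by unfold collE; positivity
  rw [← relEnergy_relState hm hE hR]
  simp only [collE, relEnergy, collide, relState, xiPrimeStd, xiStarPrimeStd, IPrimeStd,
    IStarPrimeStd]
  congr 5
  module

/-- Absolute value of the integrand of `∫ D dM dM_*`, up to symmetrization. -/
def pairDensity (w D : V3 × ℝ → ℝ) (x : (V3 × ℝ) × (V3 × ℝ)) : ℝ :=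
  |w x.1| * |w x.2| * (|D x.1| + |D x.2|)

lemma abs_mul_stdIntegrand_le {m δ α β : ℝ} (Cs : ℝ) (hm : 0 < m) (hδ : 2 ≤ δ) (hα : 0 ≤ α)
    (hβ : 0 ≤ β) (f D : V3 → ℝ → ℝ) {p q : V3 × ℝ} (hp : 0 ≤ p.2) (hq : 0 ≤ q.2)
    {ω : Sph × ℝ × ℝ} (hr : ω.2.1 ∈ Set.Icc (0 : ℝ) 1) (hR : ω.2.2 ∈ Set.Icc (0 : ℝ) 1) :
    |p.2 * stdIntegrand m δ α β Cs f (fun x J => f x J * D x J) p.1 p.2 q.1 q.2 ω.1 ω.2.1 ω.2.2| ≤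
      |Cs| * (4 / m) ^ (β / 2) * collE m p.1 q.1 p.2 q.2 ^ (1 + α + β / 2) *
        ((1 - ω.2.2) * √ω.2.2 *
            pairDensity (Function.uncurry f) (Function.uncurry D) (collide m p q ω) +
          pairDensity (Function.uncurry f) (Function.uncurry D) (p, q)) := by
  obtain ⟨ξ, I⟩ := p
  obtain ⟨ξs, Is⟩ := q
  obtain ⟨σ, r, R⟩ := ω
  simp only at hp hq hr hR ⊢
  have h1 := mul_rpow_mul_norm_rpow_le hm hα hβ ξ ξs hp hq
  have hE1 : I + Is ≤ collE m ξ ξs I Is := by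
    have : 0 ≤ m / 4 * ‖ξ - ξs‖ ^ 2 := by positivity
    rw [collE]; linarith
  have hgain := gain_kernel_le hδ hα hβ hp hq hE1 hr hR
  have hloss := loss_kernel_le ((I * Is) ^ (δ / 2 - 1)) hδ hα hβ hr hR
  have hr1' : 0 ≤ 1 - r := by linarith [hr.2]
  have hR1' : 0 ≤ 1 - R := by linarith [hR.2]
  have hr0 := hr.1
  have hR0 := hR.1
  have hE0 : 0 ≤ collE m ξ ξs I Is := by linarith
  have tri (a b c d : ℝ) : |a * (b * d) + b * (a * c)| ≤ |a| * |b| * (|c| + |d|) := by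
    refine (abs_add_le _ _).trans_eq ?_
    simp only [abs_mul]
    ring
  simp only [stdIntegrand, collide, pairDensity, Function.uncurry, IPrimeStd, IStarPrimeStd]
    at hgain ⊢
  set E := collE m ξ ξs I Is
  set ξ' := xiPrimeStd m ξ ξs I Is R σ
  set ξs' := xiStarPrimeStd m ξ ξs I Is R σ
  set I' := r * (1 - R) * E
  set Is' := (1 - r) * (1 - R) * E
  have hI' : 0 ≤ I' := by positivity
  have hIs' : 0 ≤ Is' := by positivity
  have hG := tri (f ξ' I') (f ξs' Is') (D ξ' I') (D ξs' Is')
  have hL := tri (f ξ I) (f ξs Is) (D ξ I) (D ξs Is)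
  set G := f ξ' I' * (f ξs' Is' * D ξs' Is') + f ξs' Is' * (f ξ' I' * D ξ' I')
  set L := f ξ I * (f ξs Is * D ξs Is) + f ξs Is * (f ξ I * D ξ I)
  set A := (I * Is) ^ (δ / 2 - 1)
  have hA : 0 ≤ A := by positivity
  set A' := (I' * Is') ^ (δ / 2 - 1)
  have hA' : 0 ≤ A' := by positivity
  set t := (r * (1 - r)) ^ (δ / 2 - 1)
  have ht : 0 ≤ t := by positivity
  set v := (1 - R) ^ (α + δ - 1)
  have hv : 0 ≤ v := by positivity
  set w := R ^ ((β + 1) / 2)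
  have hw : 0 ≤ w := by positivity
  set k := I * (I + Is) ^ α * ‖ξ - ξs‖ ^ β with hk
  have hk0 : 0 ≤ k := by positivity
  have e : I * ((G / A' - L / A) * (Cs * (I + Is) ^ α * ‖ξ - ξs‖ ^ β * A * t * v * w)) =
      Cs * k * (A * t * v * w / A' * G - A / A * t * v * w * L) := by
    rw [hk]; ring
  rw [e, abs_mul, abs_mul, abs_of_nonneg hk0, mul_assoc |Cs| _ (E ^ _)]
  gcongr
  refine (abs_sub _ _).trans ?_
  rw [abs_mul, abs_mul, abs_of_nonneg (by positivity : 0 ≤ A * t * v * w / A'),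
    abs_of_nonneg (by positivity : 0 ≤ A / A * t * v * w)]
  refine add_le_add (mul_le_mul hgain hG (abs_nonneg _) (by positivity)) ?_
  calc _ ≤ 1 * _ := mul_le_mul hloss hL (abs_nonneg _) zero_le_one
    _ = _ := one_mul _

lemma measurable_pairDensity {w D : V3 × ℝ → ℝ} (hw : Measurable w) (hD : Measurable D) :
    Measurable (pairDensity w D) := by
  unfold pairDensity; fun_prop

lemma lintegral_pairDensity {w D : V3 × ℝ → ℝ} (hw : Measurable w) (hD : Measurable D) :
    ∫⁻ p, ∫⁻ q, ENNReal.ofReal (pairDensity w D (p, q)) ∂phaseMeasure ∂phaseMeasure =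
      2 * (∫⁻ p, ENNReal.ofReal |w p| ∂phaseMeasure) *
        ∫⁻ p, ENNReal.ofReal (|w p| * |D p|) ∂phaseMeasure := by
  have split (p q : V3 × ℝ) : ENNReal.ofReal (pairDensity w D (p, q)) =
      ENNReal.ofReal (|w p| * |D p|) * ENNReal.ofReal |w q| +
        ENNReal.ofReal |w p| * ENNReal.ofReal (|w q| * |D q|) := by
    rw [← ENNReal.ofReal_mul (by positivity), ← ENNReal.ofReal_mul (by positivity),
      ← ENNReal.ofReal_add (by positivity) (by positivity), pairDensity]
    congr 1
    ring
  have hin (p : V3 × ℝ) : ∫⁻ q, ENNReal.ofReal (pairDensity w D (p, q)) ∂phaseMeasure =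
      ENNReal.ofReal (|w p| * |D p|) * (∫⁻ q, ENNReal.ofReal |w q| ∂phaseMeasure) +
        ENNReal.ofReal |w p| * ∫⁻ q, ENNReal.ofReal (|w q| * |D q|) ∂phaseMeasure := by
    simp_rw [split]
    rw [lintegral_add_left (by fun_prop), lintegral_const_mul _ (by fun_prop),
      lintegral_const_mul _ (by fun_prop)]
  simp_rw [hin]
  rw [lintegral_add_left (by fun_prop), lintegral_mul_const _ (by fun_prop),
    lintegral_mul_const _ (by fun_prop)]
  ring

lemma lintegral_MrTilted_mul_le (m kB δ n Ttr Tint : ℝ) (u : V3) (s : ℝ) {D : V3 × ℝ → ℝ}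
    (hD : Measurable D) :
    ∫⁻ p, ENNReal.ofReal (|MrTilted m kB δ n Ttr Tint u s p| * |D p|) ∂phaseMeasure ≤
      (∫⁻ p, ENNReal.ofReal |MrTilted m kB δ n Ttr Tint u (2 * s) p| ∂phaseMeasure) ^ (1 / 2 : ℝ) *
      (∫⁻ p, ENNReal.ofReal (D p ^ 2 * |Mr m kB δ n Ttr Tint u p.1 p.2|) ∂phaseMeasure) ^
        (1 / 2 : ℝ) := by
  have hM := measurable_Mr m kB δ n Ttr Tint u
  have hx : Measurable (MrExponent m kB Ttr Tint u) := by unfold MrExponent; fun_prop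
  have key := ENNReal.lintegral_mul_le_Lp_mul_Lq phaseMeasure Real.HolderConjugate.two_two
    (f := fun p => ENNReal.ofReal (√|Mr m kB δ n Ttr Tint u p.1 p.2| *
      Real.exp (s * MrExponent m kB Ttr Tint u p)))
    (g := fun p => ENNReal.ofReal (√|Mr m kB δ n Ttr Tint u p.1 p.2| * |D p|))
    (by fun_prop) (by fun_prop)
  simp only [Pi.mul_apply, ENNReal.rpow_two] at key
  convert key using 3 with p p p
  · rw [← ENNReal.ofReal_mul (by positivity), MrTilted, abs_mul, Real.abs_exp]
    congr 1
    linear_combination (-Real.exp (s * MrExponent m kB Ttr Tint u p) * |D p|) *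
      Real.mul_self_sqrt (abs_nonneg (Mr m kB δ n Ttr Tint u p.1 p.2))
  · refine lintegral_congr fun p => ?_
    rw [← ENNReal.ofReal_pow (by positivity), MrTilted, abs_mul, Real.abs_exp, mul_pow,
      Real.sq_sqrt (abs_nonneg _), ← Real.exp_nat_mul]
    congr 3
    push_cast
    ring
  · refine lintegral_congr fun p => ?_
    rw [← ENNReal.ofReal_pow (by positivity), mul_pow, Real.sq_sqrt (abs_nonneg _), sq_abs,
      mul_comm]

lemma ae_phaseMeasure_nonneg : ∀ᵐ p ∂phaseMeasure, 0 ≤ p.2 :=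
  Measure.quasiMeasurePreserving_snd.ae (ae_restrict_mem measurableSet_Ici)

/-- A pointwise bound on the collision integrand bounds the collision operator. -/
lemma enorm_mul_Qs_le {m δ α β Cs : ℝ} {f F : V3 → ℝ → ℝ} {p : V3 × ℝ}
    {B : (V3 × ℝ) × (Sph × ℝ × ℝ) → ℝ≥0∞} (hB : Measurable B)
    (h : ∀ q : V3 × ℝ, 0 ≤ q.2 → ∀ σ : Sph, ∀ r ∈ Set.Icc (0 : ℝ) 1, ∀ R ∈ Set.Icc (0 : ℝ) 1,
      ‖p.2 * stdIntegrand m δ α β Cs f F p.1 p.2 q.1 q.2 σ r R‖ₑ ≤ B (q, (σ, r, R))) :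
    ‖p.2 * Qs m δ α β Cs f F p.1 p.2‖ₑ ≤ ∫⁻ q, ∫⁻ ω, B (q, ω) ∂paramMeasure ∂phaseMeasure := by
  have hparam (q : V3 × ℝ) : ∫⁻ ω, B (q, ω) ∂paramMeasure =
      ∫⁻ σ : Sph, (∫⁻ r in Set.Icc (0 : ℝ) 1, ∫⁻ R in Set.Icc (0 : ℝ) 1, B (q, (σ, r, R)))
        ∂sphMeasure := by
    rw [paramMeasure, lintegral_prod _ (by fun_prop)]
    refine lintegral_congr fun σ => ?_
    rw [lintegral_prod _ (by fun_prop)]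
  have hphase : ∫⁻ q, ∫⁻ ω, B (q, ω) ∂paramMeasure ∂phaseMeasure =
      ∫⁻ Is in Set.Ici (0 : ℝ), ∫⁻ ξs : V3, ∫⁻ ω, B ((ξs, Is), ω) ∂paramMeasure := by
    rw [phaseMeasure, lintegral_prod_symm' _ hB.lintegral_prod_right']
  have hhalf : ‖(1 / 2 : ℝ)‖ₑ ≤ 1 := by
    rw [Real.enorm_eq_ofReal (by norm_num), ENNReal.ofReal_le_one]; norm_num
  rw [hphase, Qs, mul_left_comm, enorm_mul]
  simp_rw [← integral_const_mul]
  refine (mul_le_of_le_one_left' hhalf).trans ((enorm_integral_le_lintegral_enorm _).trans ?_)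
  refine setLIntegral_mono' measurableSet_Ici fun Is hIs => ?_
  refine (enorm_integral_le_lintegral_enorm _).trans (lintegral_mono fun ξs => ?_)
  rw [hparam]
  refine (enorm_integral_le_lintegral_enorm _).trans (lintegral_mono fun σ => ?_)
  refine (enorm_integral_le_lintegral_enorm _).trans
    (setLIntegral_mono' measurableSet_Icc fun r hr => ?_)
  refine (enorm_integral_le_lintegral_enorm _).trans
    (setLIntegral_mono' measurableSet_Icc fun R hR => ?_)
  exact h (ξs, Is) hIs σ r hr R hR

lemma enorm_integral_mul_Qs_le_add {m δ α β Cs : ℝ} {f F : V3 → ℝ → ℝ} {c : ℝ≥0∞}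
    {G : ((V3 × ℝ) × (V3 × ℝ)) × (Sph × ℝ × ℝ) → ℝ≥0∞} (hG : Measurable G)
    {Φ : (V3 × ℝ) × (V3 × ℝ) → ℝ≥0∞} (hΦ : Measurable Φ)
    (h : ∀ p q : V3 × ℝ, 0 ≤ p.2 → 0 ≤ q.2 → ∀ σ : Sph, ∀ r ∈ Set.Icc (0 : ℝ) 1,
      ∀ R ∈ Set.Icc (0 : ℝ) 1,
      ‖p.2 * stdIntegrand m δ α β Cs f F p.1 p.2 q.1 q.2 σ r R‖ₑ ≤
        c * (G ((p, q), (σ, r, R)) + Φ (p, q))) :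
    ‖∫ p, p.2 * Qs m δ α β Cs f F p.1 p.2 ∂phaseMeasure‖ₑ ≤
      c * ((∫⁻ p, ∫⁻ q, ∫⁻ ω, G ((p, q), ω) ∂paramMeasure ∂phaseMeasure ∂phaseMeasure) +
        paramMeasure Set.univ * ∫⁻ p, ∫⁻ q, Φ (p, q) ∂phaseMeasure ∂phaseMeasure) := by
  have hGω : Measurable fun x => ∫⁻ ω, G (x, ω) ∂paramMeasure := hG.lintegral_prod_right'
  have hGqω : Measurable fun p => ∫⁻ q, ∫⁻ ω, G ((p, q), ω) ∂paramMeasure ∂phaseMeasure :=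
    hGω.lintegral_prod_right'
  have hΦq : Measurable fun p => ∫⁻ q, Φ (p, q) ∂phaseMeasure := hΦ.lintegral_prod_right'
  have inner (p : V3 × ℝ) (hp : 0 ≤ p.2) : ‖p.2 * Qs m δ α β Cs f F p.1 p.2‖ₑ ≤
      c * ((∫⁻ q, ∫⁻ ω, G ((p, q), ω) ∂paramMeasure ∂phaseMeasure) +
        paramMeasure Set.univ * ∫⁻ q, Φ (p, q) ∂phaseMeasure) := by
    have hΦp : Measurable fun q => Φ (p, q) := hΦ.comp measurable_prodMk_left
    have hGp : Measurable fun q => ∫⁻ ω, G ((p, q), ω) ∂paramMeasure :=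
      hGω.comp measurable_prodMk_left
    refine (enorm_mul_Qs_le (B := fun y => c * (G ((p, y.1), y.2) + Φ (p, y.1))) (by fun_prop)
      fun q hq σ r hr R hR => h p q hp hq σ r hr R hR).trans_eq ?_
    have hω (q : V3 × ℝ) : ∫⁻ ω, c * (G ((p, q), ω) + Φ (p, q)) ∂paramMeasure =
        c * ((∫⁻ ω, G ((p, q), ω) ∂paramMeasure) + paramMeasure Set.univ * Φ (p, q)) := by
      rw [lintegral_const_mul _ (by fun_prop), lintegral_add_right _ measurable_const,
        lintegral_const, mul_comm (Φ _)]
    rw [lintegral_congr hω, lintegral_const_mul _ (by fun_prop),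
      lintegral_add_left hGp, lintegral_const_mul _ hΦp]
  refine ((enorm_integral_le_lintegral_enorm _).trans
    (lintegral_mono_ae (ae_phaseMeasure_nonneg.mono inner))).trans_eq ?_
  rw [lintegral_const_mul _ (by fun_prop), lintegral_add_left hGqω,
    lintegral_const_mul _ hΦq]

/-- The collision operator is bounded in the mean by a gain and a loss term, both controlled by
the same two-particle density. -/
lemma enorm_integral_mul_Qs_le {m δ α β Cs : ℝ} (hm : 0 < m) {f F : V3 → ℝ → ℝ} {c : ℝ≥0∞}
    {Φ : (V3 × ℝ) × (V3 × ℝ) → ℝ≥0∞} (hΦ : Measurable Φ)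
    (h : ∀ p q : V3 × ℝ, 0 ≤ p.2 → 0 ≤ q.2 → ∀ σ : Sph, ∀ r ∈ Set.Icc (0 : ℝ) 1,
      ∀ R ∈ Set.Icc (0 : ℝ) 1,
      ‖p.2 * stdIntegrand m δ α β Cs f F p.1 p.2 q.1 q.2 σ r R‖ₑ ≤ c *
        (paramWeight (σ, r, R) * Φ (collide m p q (σ, r, R)) + Φ (p, q))) :
    ‖∫ p, p.2 * Qs m δ α β Cs f F p.1 p.2 ∂phaseMeasure‖ₑ ≤
      c * (((∫⁻ ω, paramWeight ω ∂paramMeasure) + paramMeasure Set.univ) *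
        ∫⁻ p, ∫⁻ q, Φ (p, q) ∂phaseMeasure ∂phaseMeasure) := by
  refine (enorm_integral_mul_Qs_le_add
    (G := fun y => paramWeight y.2 * Φ (collide m y.1.1 y.1.2 y.2))
    ((measurable_paramWeight.comp measurable_snd).mul (hΦ.comp (measurable_collide m)))
    hΦ h).trans_eq ?_
  rw [add_mul, ← lintegral_collide hm hΦ]

/-- The collision integrand is bounded by two-particle densities built from a tilted equilibrium,
which absorbs the growth of the kernel. -/
lemma exists_enorm_mul_stdIntegrand_le {m kB δ α β : ℝ} (hm : 0 < m) (hkB : 0 < kB) (hδ : 2 ≤ δ)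
    (hα : 0 ≤ α) (hβ : 0 ≤ β) (Cs n : ℝ) {Ttr Tint : ℝ} (hTtr : 0 < Ttr) (hTint : 0 < Tint)
    (u : V3) :
    ∃ c : ℝ, ∀ D : V3 → ℝ → ℝ, ∀ p q : V3 × ℝ, 0 ≤ p.2 → 0 ≤ q.2 →
      ∀ σ : Sph, ∀ r ∈ Set.Icc (0 : ℝ) 1, ∀ R ∈ Set.Icc (0 : ℝ) 1,
      ‖p.2 * stdIntegrand m δ α β Cs (Mr m kB δ n Ttr Tint u)
        (fun x J => Mr m kB δ n Ttr Tint u x J * D x J) p.1 p.2 q.1 q.2 σ r R‖ₑ ≤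
      ENNReal.ofReal c * (paramWeight (σ, r, R) *
        ENNReal.ofReal (pairDensity (MrTilted m kB δ n Ttr Tint u (1 / 4)) (Function.uncurry D)
          (collide m p q (σ, r, R))) +
        ENNReal.ofReal (pairDensity (MrTilted m kB δ n Ttr Tint u (1 / 4)) (Function.uncurry D)
          (p, q))) := by
  obtain ⟨C₁, hC₁, hE⟩ := exists_collE_rpow_mul_Mr_le hm hkB hTtr hTint δ n u
    (show 0 ≤ 1 + α + β / 2 by linarith)
  set W := MrTilted m kB δ n Ttr Tint u (1 / 4)
  set c : ℝ := |Cs| * (4 / m) ^ (β / 2) * C₁ with hc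
  have hc0 : 0 ≤ c := by positivity
  refine ⟨c, fun D p q hp hq σ r hr R hR => ?_⟩
  have hnn (x : (V3 × ℝ) × (V3 × ℝ)) : 0 ≤ pairDensity W (Function.uncurry D) x := by
    unfold pairDensity; positivity
  have hw : 0 ≤ (1 - R) * √R := mul_nonneg (by linarith [hR.2]) (Real.sqrt_nonneg _)
  have hEcoll := collE_collide hm hp hq (ω := (σ, r, R)) hR.1
  have hE0 : 0 ≤ collE m p.1 q.1 p.2 q.2 := by unfold collE; positivity
  have absorb (x : (V3 × ℝ) × (V3 × ℝ)) (h1 : 0 ≤ x.1.2) (h2 : 0 ≤ x.2.2) :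
      collE m x.1.1 x.2.1 x.1.2 x.2.2 ^ (1 + α + β / 2) *
        pairDensity (Function.uncurry (Mr m kB δ n Ttr Tint u)) (Function.uncurry D) x ≤
      C₁ * pairDensity W (Function.uncurry D) x := by
    have h := mul_le_mul_of_nonneg_right (hE x.1 x.2 h1 h2)
      (by positivity : 0 ≤ |Function.uncurry D x.1| + |Function.uncurry D x.2|)
    simp only [pairDensity, Function.uncurry] at h ⊢
    linarith
  have hI' : 0 ≤ (collide m p q (σ, r, R)).1.2 :=
    mul_nonneg (mul_nonneg hr.1 (by linarith [hR.2])) hE0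
  have hIs' : 0 ≤ (collide m p q (σ, r, R)).2.2 :=
    mul_nonneg (mul_nonneg (by linarith [hr.2]) (by linarith [hR.2])) hE0
  have hgain := absorb (collide m p q (σ, r, R)) hI' hIs'
  have hloss := absorb (p, q) hp hq
  rw [hEcoll] at hgain
  rw [paramWeight, ← ENNReal.ofReal_mul hw, ← ENNReal.ofReal_add (mul_nonneg hw (hnn _)) (hnn _),
    ← ENNReal.ofReal_mul hc0, Real.enorm_eq_ofReal_abs]
  refine ENNReal.ofReal_le_ofReal ?_
  refine (abs_mul_stdIntegrand_le Cs hm hδ hα hβ (Mr m kB δ n Ttr Tint u) D hp hq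
    (ω := (σ, r, R)) hr hR).trans ?_
  have h1 := add_le_add (mul_le_mul_of_nonneg_left hgain hw) hloss
  have h2 := mul_le_mul_of_nonneg_left h1 (show 0 ≤ |Cs| * (4 / m) ^ (β / 2) by positivity)
  simp only [hc] at h2 ⊢
  linarith

/-- Cauchy–Schwarz bound for the linearized source term. -/
theorem source_term_cauchy_schwarz (m kB δ α β Cr Cs : ℝ) (hm : 0 < m) (hkB : 0 < kB) (hδ : 2 ≤ δ)
    (hα : α ∈ Set.Ico (0:ℝ) (δ / 2)) (hβ : β ∈ Set.Icc (0:ℝ) 1) (hCr : 0 < Cr)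
    (hCs : Cs = Real.Gamma (δ + α + (β + 3) / 2) /
      (Real.Gamma ((β + 3) / 2) * Real.Gamma (δ + α)) * Cr)
    (n Ttr Tint : ℝ) (hn : 0 < n) (hTtr : 0 < Ttr) (hTint : 0 < Tint) (u : V3) :
    ∃ C : ℝ, 0 < C ∧ ∀ D : V3 → ℝ → ℝ, Measurable (Function.uncurry D) →
      Integrable (fun p : V3 × ℝ =>
        D p.1 p.2 ^ 2 * Mr m kB δ n Ttr Tint u p.1 p.2) phaseMeasure →
      Integrable (fun p : V3 × ℝ × V3 × ℝ × Sph × ℝ × ℝ =>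
        stdIntegrand m δ α β Cs (Mr m kB δ n Ttr Tint u)
            (fun x J => Mr m kB δ n Ttr Tint u x J * D x J)
            p.1 p.2.1 p.2.2.1 p.2.2.2.1 p.2.2.2.2.1 p.2.2.2.2.2.1 p.2.2.2.2.2.2 *
          p.2.1) stdMeasure →
      (∫ p, p.2 * Qs m δ α β Cs (Mr m kB δ n Ttr Tint u)
          (fun x J => Mr m kB δ n Ttr Tint u x J * D x J) p.1 p.2 ∂phaseMeasure) ^ 2 ≤
        C * ∫ p, D p.1 p.2 ^ 2 * Mr m kB δ n Ttr Tint u p.1 p.2 ∂phaseMeasure := by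
  obtain ⟨hα0, -⟩ := hα
  obtain ⟨hβ0, -⟩ := hβ
  obtain ⟨c, hc⟩ := exists_enorm_mul_stdIntegrand_le (α := α) (β := β) hm hkB hδ hα0 hβ0 Cs n
    hTtr hTint u
  set W := MrTilted m kB δ n Ttr Tint u (1 / 4) with hW
  have hWm : Measurable W := measurable_MrTilted m kB δ n Ttr Tint u _
  have finite {s : ℝ} (hs : s < 1) :
      ∫⁻ p, ENNReal.ofReal |MrTilted m kB δ n Ttr Tint u s p| ∂phaseMeasure < ∞ := by
    have h := (integrable_MrTilted hm hkB hδ hTtr hTint u hs (n := n)).hasFiniteIntegral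
    simpa only [HasFiniteIntegral, ← Real.enorm_eq_ofReal_abs] using h
  set K : ℝ≥0∞ := ENNReal.ofReal c *
    (((∫⁻ ω, paramWeight ω ∂paramMeasure) + paramMeasure Set.univ) *
      (2 * (∫⁻ p, ENNReal.ofReal |W p| ∂phaseMeasure) *
        (∫⁻ p, ENNReal.ofReal |MrTilted m kB δ n Ttr Tint u (2 * (1 / 4)) p| ∂phaseMeasure) ^
          (1 / 2 : ℝ))) with hK
  have hKtop : K ≠ ∞ := by
    refine ENNReal.mul_ne_top ENNReal.ofReal_ne_top (ENNReal.mul_ne_top ?_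
      (ENNReal.mul_ne_top (ENNReal.mul_ne_top (by simp) (finite (by norm_num)).ne) ?_))
    · exact ENNReal.add_ne_top.2 ⟨lintegral_paramWeight_lt_top.ne, measure_ne_top _ _⟩
    · exact ENNReal.rpow_ne_top_of_nonneg (by norm_num) (finite (by norm_num)).ne
  refine ⟨K.toReal ^ 2 + 1, by positivity, fun D hD hDM _ => ?_⟩
  set N := ∫⁻ p, ENNReal.ofReal (Function.uncurry D p ^ 2 *
    |Mr m kB δ n Ttr Tint u p.1 p.2|) ∂phaseMeasure with hN
  have total : ‖∫ p, p.2 * Qs m δ α β Cs (Mr m kB δ n Ttr Tint u)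
      (fun x J => Mr m kB δ n Ttr Tint u x J * D x J) p.1 p.2 ∂phaseMeasure‖ₑ ≤
      K * N ^ (1 / 2 : ℝ) := by
    refine (enorm_integral_mul_Qs_le hm (measurable_pairDensity hWm hD).ennreal_ofReal
      (hc D)).trans ?_
    rw [lintegral_pairDensity hWm hD, hK]
    simp only [mul_assoc]
    gcongr
    exact lintegral_MrTilted_mul_le m kB δ n Ttr Tint u (1 / 4) hD
  have hcongr : (fun p : V3 × ℝ => D p.1 p.2 ^ 2 * Mr m kB δ n Ttr Tint u p.1 p.2)
      =ᵐ[phaseMeasure] fun p => Function.uncurry D p ^ 2 * |Mr m kB δ n Ttr Tint u p.1 p.2| := by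
    filter_upwards [ae_phaseMeasure_nonneg] with p hp
    rw [abs_of_nonneg (Mr_nonneg hm hkB hδ hn hTtr hTint u p.1 hp)]
    rfl
  have hNreal : N = ENNReal.ofReal
      (∫ p, D p.1 p.2 ^ 2 * Mr m kB δ n Ttr Tint u p.1 p.2 ∂phaseMeasure) := by
    rw [integral_congr_ae hcongr, ofReal_integral_eq_lintegral_ofReal (hDM.congr hcongr)
      (.of_forall fun p => by positivity)]
  set J := ∫ p, D p.1 p.2 ^ 2 * Mr m kB δ n Ttr Tint u p.1 p.2 ∂phaseMeasure
  have hJ : 0 ≤ J := by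
    rw [show J = _ from integral_congr_ae hcongr]
    exact integral_nonneg fun p => by positivity
  have hreal := ENNReal.toReal_mono (ENNReal.mul_ne_top hKtop
    (ENNReal.rpow_ne_top_of_nonneg (by norm_num) (hNreal ▸ ENNReal.ofReal_ne_top))) total
  rw [toReal_enorm, Real.norm_eq_abs, ENNReal.toReal_mul, ← ENNReal.toReal_rpow, hNreal,
    ENNReal.toReal_ofReal hJ, ← Real.sqrt_eq_rpow] at hreal
  calc _ = |∫ p, p.2 * Qs m δ α β Cs (Mr m kB δ n Ttr Tint u)
        (fun x J => Mr m kB δ n Ttr Tint u x J * D x J) p.1 p.2 ∂phaseMeasure| ^ 2 :=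
        (sq_abs _).symm
    _ ≤ (K.toReal * √J) ^ 2 := by gcongr
    _ = K.toReal ^ 2 * J := by rw [mul_pow, Real.sq_sqrt hJ]
    _ ≤ (K.toReal ^ 2 + 1) * J := by gcongr; linarith
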